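/- Let X be a nonempty set and let F be a filter on X that is proper (∅ ∉ F) and closed under countable intersections. Then the relation on ordinal-valued functions defined by f < g if and only if {x ∈ X : f(x) < g(x)} ∈ F is a well-founded relation on the set of all functions from X to the ordinals. (In particular, since the club filter on ω₁ is countably complete, the ordering f <_{NS} g iff {ξ : f(ξ) < g(ξ)} contains a club is well founded, so the Galvin–Hajnal norm ||f|| is well defined.) -/

import Mathlib

/-- Let `X` be a nonempty set and `F` a proper filter on `X` closed under countable
intersections. Then the relation `f < g ↔ {x | f x < g x} ∈ F` on ordinal-valued
functions on `X` is well founded. -/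
theorem stmt_0 {X : Type*} [Nonempty X] (F : Filter X)
    (hproper : ∅ ∉ F)
    (hcc : ∀ s : Set (Set X), s.Countable → (∀ t ∈ s, t ∈ F) → ⋂₀ s ∈ F) :
    WellFounded (fun f g : X → Ordinal => {x | f x < g x} ∈ F) := by
  rw [wellFounded_iff_isEmpty_descending_chain]
  refine ⟨fun ⟨f, hf⟩ => ?_⟩
  have h := hcc (Set.range fun n => {x | f (n + 1) x < f n x}) (Set.countable_range _)
    (by rintro _ ⟨n, rfl⟩; exact hf n)
  rcases Set.eq_empty_or_nonempty (⋂₀ (Set.range fun n => {x | f (n + 1) x < f n x})) with he | ⟨x, hx⟩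
  · rw [he] at h
    exact hproper h
  · have hlt : ∀ n, f (n + 1) x < f n x := fun n => hx _ ⟨n, rfl⟩
    exact (wellFounded_iff_isEmpty_descending_chain.1
      (wellFounded_lt (α := Ordinal))).false ⟨fun n => f n x, hlt⟩
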